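/- arXiv:2011.01829 — 5 statements merged into one kernel-verified Lean document; each statement's English description precedes it below -/
import Mathlib

section
/- Let X₀, X₁, …, X_r be subsets of a group G and let F₁, …, F_r ⊆ G be finite subsets such that X₀ ⊆ F_i·X_i for all 1 ≤ i ≤ r. Then there exists a finite subset F ⊆ G with |F| ≤ |F₁|·…·|F_r| such that X₀ ⊆ F·⋂_{1 ≤ i ≤ r} X_i⁻¹·X_i. -/
open Pointwise

theorem intersection_covering {G : Type*} [Group G] (r : ℕ)
    (X₀ : Set G) (X : Fin r → Set G) (F : Fin r → Finset G)
    (hcov : ∀ i : Fin r, X₀ ⊆ (F i : Set G) * X i) :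
    ∃ F' : Finset G, F'.card ≤ ∏ i : Fin r, (F i).card ∧
      X₀ ⊆ (F' : Set G) * ⋂ i : Fin r, (X i)⁻¹ * X i := by
  classical
  -- `g t` is a common point of the translates `t i • X i`, whenever there is one.
  have hg : ∀ t : Fin r → G, ∃ y : G,
      (∃ x, ∀ i, (t i)⁻¹ * x ∈ X i) → ∀ i, (t i)⁻¹ * y ∈ X i := by
    intro t
    by_cases h : ∃ x, ∀ i, (t i)⁻¹ * x ∈ X i
    · exact h.imp fun _ hx _ => hx
    · exact ⟨1, fun h' => absurd h' h⟩
  choose g hg using hg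
  refine ⟨(Fintype.piFinset F).image g,
    Finset.card_image_le.trans (Fintype.card_piFinset F).le, fun x hx => ?_⟩
  have hx_cov : ∀ i, ∃ a ∈ F i, a⁻¹ * x ∈ X i := by
    intro i
    obtain ⟨a, ha, b, hb, rfl⟩ := hcov i hx
    exact ⟨a, ha, by simpa using hb⟩
  choose t htF htX using hx_cov
  refine ⟨g t, Finset.mem_image_of_mem g (Fintype.mem_piFinset.2 htF), (g t)⁻¹ * x,
    Set.mem_iInter.2 fun i => ?_, mul_inv_cancel_left _ _⟩
  exact ⟨((t i)⁻¹ * g t)⁻¹, Set.inv_mem_inv.2 (hg t ⟨x, htX⟩ i), (t i)⁻¹ * x, htX i, by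
    simp [mul_assoc]⟩
end

section
/- Let K₁, …, K_r be positive integers and for each 1 ≤ i ≤ r let Λ_i be a K_i-approximate subgroup of a group G. Then: (1) ⋂_{1 ≤ i ≤ r} Λ_i² is a K₁³·…·K_r³-approximate subgroup of G; (2) if Ξ_i is an approximate subgroup commensurable to Λ_i for each 1 ≤ i ≤ r, then ⋂_{1 ≤ i ≤ r} Λ_i² and ⋂_{1 ≤ i ≤ r} Ξ_i² are commensurable. -/
open Pointwise

def IsKApproxSubgroup {G : Type*} [Group G] (K : ℕ) (Λ : Set G) : Prop :=
  Λ⁻¹ = Λ ∧ (1 : G) ∈ Λ ∧ ∃ F : Finset G, F.card ≤ K ∧ Λ * Λ ⊆ (F : Set G) * Λ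

def IsApproxSubgroup {G : Type*} [Group G] (Λ : Set G) : Prop :=
  Λ⁻¹ = Λ ∧ (1 : G) ∈ Λ ∧ ∃ F : Finset G, Λ * Λ ⊆ (F : Set G) * Λ

def AreCommensurable {G : Type*} [Group G] (X Y : Set G) : Prop :=
  ∃ F : Finset G, X ⊆ (F : Set G) * Y ∧ Y ⊆ (F : Set G) * X

/-- If a set is covered by finitely many left translates of each `A i`, then it is covered by
finitely many left translates of the intersection of the sets `(A i)⁻¹ * A i`. -/
theorem exists_subset_mul_iInter_inv_mul {G ι : Type*} [Group G] [Fintype ι] {S : Set G}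
    {A : ι → Set G} {F : ι → Finset G} (h : ∀ i, S ⊆ (F i : Set G) * A i) :
    ∃ E : Finset G, E.card ≤ ∏ i, (F i).card ∧ S ⊆ (E : Set G) * ⋂ i, (A i)⁻¹ * A i := by
  classical
  have hrep : ∀ f : ι → G, ∃ t : G, ∀ s ∈ S, (∀ i, (f i)⁻¹ * s ∈ A i) →
      ∀ i, (f i)⁻¹ * t ∈ A i := by
    intro f
    by_cases hf : ∃ s ∈ S, ∀ i, (f i)⁻¹ * s ∈ A i
    · obtain ⟨t, -, ht⟩ := hf
      exact ⟨t, fun _ _ _ => ht⟩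
    · exact ⟨1, fun s hs hsA => absurd ⟨s, hs, hsA⟩ hf⟩
  choose t ht using hrep
  refine ⟨(Fintype.piFinset F).image t, Finset.card_image_le.trans_eq (Fintype.card_piFinset F), ?_⟩
  intro s hs
  have hcover : ∀ i, ∃ f ∈ F i, f⁻¹ * s ∈ A i := by
    intro i
    obtain ⟨f, hf, a, ha, rfl⟩ := Set.mem_mul.1 (h i hs)
    exact ⟨f, hf, by simpa using ha⟩
  choose f hfF hfA using hcover
  refine Set.mem_mul.2 ⟨t f, Finset.mem_coe.2 (Finset.mem_image_of_mem t
    (Fintype.mem_piFinset.2 hfF)), (t f)⁻¹ * s, Set.mem_iInter.2 fun i => ?_, by group⟩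
  exact Set.mem_mul.2 ⟨((f i)⁻¹ * t f)⁻¹, Set.inv_mem_inv.2 (ht f s hs hfA i),
    (f i)⁻¹ * s, hfA i, by group⟩

theorem IsKApproxSubgroup.isApproxSubgroup {G : Type*} [Group G] {K : ℕ} {Λ : Set G}
    (h : IsKApproxSubgroup K Λ) : IsApproxSubgroup Λ :=
  ⟨h.1, h.2.1, h.2.2.imp fun _ hF => hF.2⟩

theorem AreCommensurable.symm {G : Type*} [Group G] {X Y : Set G} (h : AreCommensurable X Y) :
    AreCommensurable Y X :=
  h.imp fun _ hF => hF.symm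

theorem AreCommensurable.of_subset_mul {G : Type*} [Group G] {X Y : Set G} {E F : Finset G}
    (hXY : X ⊆ (E : Set G) * Y) (hYX : Y ⊆ (F : Set G) * X) : AreCommensurable X Y := by
  classical
  refine ⟨E ∪ F, hXY.trans (Set.mul_subset_mul_right ?_),
    hYX.trans (Set.mul_subset_mul_right ?_)⟩ <;> simp

theorem IsKApproxSubgroup.exists_mul_self_mul_mul_self_subset {G : Type*} [Group G] {K : ℕ}
    {Λ : Set G} (h : IsKApproxSubgroup K Λ) :
    ∃ F : Finset G, F.card ≤ K ^ 3 ∧ Λ * Λ * (Λ * Λ) ⊆ (F : Set G) * Λ := by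
  classical
  obtain ⟨-, -, F, hF, hΛ⟩ := h
  refine ⟨F ^ 3, Finset.card_pow_le.trans (Nat.pow_le_pow_left hF 3), ?_⟩
  calc Λ * Λ * (Λ * Λ) ⊆ F * Λ * (Λ * Λ) := Set.mul_subset_mul_right hΛ
    _ = F * (Λ * Λ * Λ) := by simp only [mul_assoc]
    _ ⊆ F * (F * Λ * Λ) := Set.mul_subset_mul_left (Set.mul_subset_mul_right hΛ)
    _ = F * (F * (Λ * Λ)) := by simp only [mul_assoc]
    _ ⊆ F * (F * (F * Λ)) := Set.mul_subset_mul_left (Set.mul_subset_mul_left hΛ)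
    _ = _ := by rw [Finset.coe_pow]; simp only [pow_succ, pow_zero, one_mul, mul_assoc]

theorem IsApproxSubgroup.exists_iInter_mul_self_subset {G ι : Type*} [Group G] [Fintype ι]
    {Λ Ξ : ι → Set G} (hΛ : ∀ i, IsApproxSubgroup (Λ i)) (hΞ : ∀ i, IsApproxSubgroup (Ξ i))
    (h : ∀ i, AreCommensurable (Λ i) (Ξ i)) :
    ∃ E : Finset G, ⋂ i, Λ i * Λ i ⊆ (E : Set G) * ⋂ i, Ξ i * Ξ i := by
  classical
  choose F hF using fun i => (hΛ i).2.2
  choose C hC _ using h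
  have hcover : ∀ i, ⋂ j, Λ j * Λ j ⊆ ((F i * C i : Finset G) : Set G) * Ξ i := fun i =>
    calc ⋂ j, Λ j * Λ j ⊆ Λ i * Λ i := Set.iInter_subset _ i
      _ ⊆ F i * Λ i := hF i
      _ ⊆ F i * (C i * Ξ i) := Set.mul_subset_mul_left (hC i)
      _ = _ := by rw [Finset.coe_mul, mul_assoc]
  obtain ⟨E, -, hE⟩ := exists_subset_mul_iInter_inv_mul hcover
  exact ⟨E, by simpa only [(hΞ _).1] using hE⟩

theorem intersection_of_approximate_subgroups {G : Type*} [Group G] (r : ℕ)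
    (K : Fin r → ℕ) (hK : ∀ i, 0 < K i) (Λ : Fin r → Set G)
    (hΛ : ∀ i, IsKApproxSubgroup (K i) (Λ i)) :
    IsKApproxSubgroup (∏ i : Fin r, (K i) ^ 3) (⋂ i : Fin r, Λ i * Λ i) ∧
    (∀ Ξ : Fin r → Set G,
      (∀ i, IsApproxSubgroup (Ξ i) ∧ AreCommensurable (Λ i) (Ξ i)) →
      AreCommensurable (⋂ i : Fin r, Λ i * Λ i) (⋂ i : Fin r, Ξ i * Ξ i)) := by
  refine ⟨⟨?_, ?_, ?_⟩, fun Ξ hΞ => ?_⟩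
  · simp only [Set.iInter_inv, mul_inv_rev, (hΛ _).1]
  · exact Set.mem_iInter.2 fun i => Set.mem_mul.2 ⟨1, (hΛ i).2.1, 1, (hΛ i).2.1, one_mul 1⟩
  · choose F hFcard hF using fun i => (hΛ i).exists_mul_self_mul_mul_self_subset
    have hcover : ∀ i, (⋂ j, Λ j * Λ j) * (⋂ j, Λ j * Λ j) ⊆ (F i : Set G) * Λ i := fun i =>
      (Set.mul_subset_mul (Set.iInter_subset _ i) (Set.iInter_subset _ i)).trans (hF i)
    obtain ⟨E, hEcard, hE⟩ := exists_subset_mul_iInter_inv_mul hcover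
    exact ⟨E, hEcard.trans (Finset.prod_le_prod' fun i _ => hFcard i),
      by simpa only [(hΛ _).1] using hE⟩
  · have hΛ' i := (hΛ i).isApproxSubgroup
    obtain ⟨E, hE⟩ := IsApproxSubgroup.exists_iInter_mul_self_subset hΛ'
      (fun i => (hΞ i).1) fun i => (hΞ i).2
    obtain ⟨E', hE'⟩ := IsApproxSubgroup.exists_iInter_mul_self_subset
      (fun i => (hΞ i).1) hΛ' fun i => (hΞ i).2.symm
    exact .of_subset_mul hE hE'
end

section
/- Let Λ₁ and Λ₂ be two commensurable approximate subgroups of a group G and let φ : H → G be a group homomorphism. Then φ⁻¹(Λ₁²) and φ⁻¹(Λ₂²) are commensurable approximate subgroups of H. -/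
open Pointwise

theorem exists_finset_preimage_subset_mul {G H : Type*} [Group G] [Group H] (φ : H →* G)
    {X Y : Set G} (hY : Y⁻¹ = Y) {F : Set G} (hF : F.Finite) (hX : X ⊆ F * Y) :
    ∃ E : Finset H, φ ⁻¹' X ⊆ (E : Set H) * φ ⁻¹' (Y * Y) := by
  classical
  have key : ∀ f : G, ∃ a : H, ∀ h : H, f⁻¹ * φ h ∈ Y → φ (a⁻¹ * h) ∈ Y * Y := by
    intro f
    by_cases hf : ∃ a : H, f⁻¹ * φ a ∈ Y
    · obtain ⟨a, ha⟩ := hf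
      refine ⟨a, fun h hh => ⟨(f⁻¹ * φ a)⁻¹, ?_, f⁻¹ * φ h, hh, by simp⟩⟩
      rw [← hY]
      exact Set.inv_mem_inv.2 ha
    · exact ⟨1, fun h hh => (hf ⟨h, hh⟩).elim⟩
  choose a ha using key
  refine ⟨hF.toFinset.image a, fun h hh => ?_⟩
  obtain ⟨f, hf, y, hy, hfy⟩ := hX hh
  refine ⟨a f, by simpa using ⟨f, hf, rfl⟩, (a f)⁻¹ * h, ha f h ?_, by simp⟩
  rwa [← hfy, inv_mul_cancel_left]

theorem IsApproxSubgroup.preimage_mul_self {G H : Type*} [Group G] [Group H] {Λ : Set G}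
    (hΛ : IsApproxSubgroup Λ) (φ : H →* G) : IsApproxSubgroup (φ ⁻¹' (Λ * Λ)) := by
  obtain ⟨hinv, hone, F, hF⟩ := hΛ
  refine ⟨?_, ?_, ?_⟩
  · ext h
    rw [Set.mem_inv, Set.mem_preimage, Set.mem_preimage, map_inv, ← Set.mem_inv, mul_inv_rev, hinv]
  · exact ⟨1, hone, 1, hone, by simp⟩
  · have hcover : Λ * Λ * (Λ * Λ) ⊆ (F * F * F : Set G) * Λ :=
      calc Λ * Λ * (Λ * Λ) ⊆ F * Λ * (Λ * Λ) := Set.mul_subset_mul_right hF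
        _ = F * (Λ * Λ * Λ) := by simp only [mul_assoc]
        _ ⊆ F * (F * Λ * Λ) := Set.mul_subset_mul_left (Set.mul_subset_mul_right hF)
        _ = F * F * (Λ * Λ) := by simp only [mul_assoc]
        _ ⊆ F * F * (F * Λ) := Set.mul_subset_mul_left hF
        _ = F * F * F * Λ := by simp only [mul_assoc]
    obtain ⟨E, hE⟩ := exists_finset_preimage_subset_mul φ hinv
      ((F.finite_toSet.mul F.finite_toSet).mul F.finite_toSet) hcover
    exact ⟨E, (Set.preimage_mul_preimage_subset φ).trans hE⟩

theorem exists_finset_preimage_mul_self_subset {G H : Type*} [Group G] [Group H] {X Y : Set G}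
    (hX : IsApproxSubgroup X) (hY : IsApproxSubgroup Y) {F : Finset G} (hF : X ⊆ (F : Set G) * Y)
    (φ : H →* G) : ∃ E : Finset H, φ ⁻¹' (X * X) ⊆ (E : Set H) * φ ⁻¹' (Y * Y) := by
  obtain ⟨-, -, K, hK⟩ := hX
  refine exists_finset_preimage_subset_mul φ hY.1 (K.finite_toSet.mul F.finite_toSet) ?_
  rw [mul_assoc]
  exact hK.trans (Set.mul_subset_mul_left hF)

theorem pullback_of_commensurable_approximate_subgroups {G H : Type*} [Group G] [Group H]
    (Λ₁ Λ₂ : Set G) (hΛ₁ : IsApproxSubgroup Λ₁) (hΛ₂ : IsApproxSubgroup Λ₂)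
    (hcomm : AreCommensurable Λ₁ Λ₂) (φ : H →* G) :
    IsApproxSubgroup (φ ⁻¹' (Λ₁ * Λ₁)) ∧ IsApproxSubgroup (φ ⁻¹' (Λ₂ * Λ₂)) ∧
      AreCommensurable (φ ⁻¹' (Λ₁ * Λ₁)) (φ ⁻¹' (Λ₂ * Λ₂)) := by
  classical
  refine ⟨hΛ₁.preimage_mul_self φ, hΛ₂.preimage_mul_self φ, ?_⟩
  obtain ⟨F, h₁₂, h₂₁⟩ := hcomm
  obtain ⟨E₁, hE₁⟩ := exists_finset_preimage_mul_self_subset hΛ₁ hΛ₂ h₁₂ φ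
  obtain ⟨E₂, hE₂⟩ := exists_finset_preimage_mul_self_subset hΛ₂ hΛ₁ h₂₁ φ
  refine ⟨E₁ ∪ E₂, hE₁.trans (Set.mul_subset_mul_right ?_),
    hE₂.trans (Set.mul_subset_mul_right ?_)⟩ <;> simp
end

section
/- Let Λ be a closed approximate subgroup of ℝⁿ (with addition). Then there exist linear subspaces V_o and V_d of ℝⁿ with V_o ⊕ V_d = ℝⁿ, a uniformly discrete approximate subgroup Λ_d ⊆ V_d, and a compact approximate subgroup K ⊆ V_d, such that Λ is commensurable to V_o + Λ_d + K. -/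
open Pointwise

def IsAddApproxSubgroup {G : Type*} [AddGroup G] (Λ : Set G) : Prop :=
  -Λ = Λ ∧ (0 : G) ∈ Λ ∧ ∃ F : Finset G, Λ + Λ ⊆ (F : Set G) + Λ

def AreAddCommensurable {G : Type*} [AddGroup G] (X Y : Set G) : Prop :=
  ∃ F : Finset G, X ⊆ (F : Set G) + Y ∧ Y ⊆ (F : Set G) + X

open Filter Topology

/-- `X` is covered by finitely many translates of `Y`. -/
def FinitelyCovered {G : Type*} [AddGroup G] (X Y : Set G) : Prop :=
  ∃ F : Set G, F.Finite ∧ X ⊆ F + Y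

namespace FinitelyCovered

variable {G : Type*} [AddCommGroup G] {X Y Z Λ : Set G}

theorem of_subset (h : X ⊆ Y) : FinitelyCovered X Y :=
  ⟨{0}, Set.finite_singleton 0, by simpa using h⟩

theorem trans (h₁ : FinitelyCovered X Y) (h₂ : FinitelyCovered Y Z) : FinitelyCovered X Z := by
  obtain ⟨F₁, hF₁, h₁⟩ := h₁
  obtain ⟨F₂, hF₂, h₂⟩ := h₂
  refine ⟨F₁ + F₂, hF₁.add hF₂, h₁.trans ?_⟩
  rw [add_assoc]
  exact Set.add_subset_add_left h₂

theorem add (hΛ : FinitelyCovered (Λ + Λ) Λ) (hX : FinitelyCovered X Λ)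
    (hY : FinitelyCovered Y Λ) : FinitelyCovered (X + Y) Λ := by
  obtain ⟨F₁, hF₁, h₁⟩ := hX
  obtain ⟨F₂, hF₂, h₂⟩ := hY
  refine trans ⟨F₁ + F₂, hF₁.add hF₂, (Set.add_subset_add h₁ h₂).trans ?_⟩ hΛ
  rw [add_add_add_comm]

end FinitelyCovered

theorem isAddApproxSubgroup_iff_finitelyCovered {G : Type*} [AddGroup G] {Λ : Set G} :
    IsAddApproxSubgroup Λ ↔ -Λ = Λ ∧ (0 : G) ∈ Λ ∧ FinitelyCovered (Λ + Λ) Λ := by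
  refine and_congr_right fun _ => and_congr_right fun _ => ⟨?_, ?_⟩
  · rintro ⟨F, hF⟩
    exact ⟨F, F.finite_toSet, hF⟩
  · rintro ⟨F, hF, h⟩
    exact ⟨hF.toFinset, by simpa using h⟩

/-- The square of an approximate subgroup meets any subgroup in an approximate subgroup. -/
theorem IsAddApproxSubgroup.add_self_inter {G : Type*} [AddCommGroup G] {A : Set G}
    (hA : IsAddApproxSubgroup A) (D : AddSubgroup G) :
    IsAddApproxSubgroup ((A + A) ∩ (D : Set G)) := by
  rw [isAddApproxSubgroup_iff_finitelyCovered] at hA ⊢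
  obtain ⟨hneg, h0, hAA⟩ := hA
  refine ⟨?_, ⟨⟨0, h0, 0, h0, add_zero 0⟩, D.zero_mem⟩, ?_⟩
  · rw [Set.inter_neg, neg_add, hneg]
    simp
  obtain ⟨F, hF, h⟩ := FinitelyCovered.add hAA hAA hAA
  classical
  have hsel : ∀ f : G, ∃ d : G, (∃ x ∈ D, ∃ a ∈ A, f + a = x) →
      d ∈ D ∧ ∃ a ∈ A, f + a = d := by
    intro f
    by_cases hf : ∃ x ∈ D, ∃ a ∈ A, f + a = x
    · obtain ⟨x, hx, hx'⟩ := hf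
      exact ⟨x, fun _ => ⟨hx, hx'⟩⟩
    · exact ⟨0, fun h => absurd h hf⟩
  choose d hd using hsel
  refine ⟨d '' F, hF.image d, ?_⟩
  rintro _ ⟨x, ⟨hx, hxD⟩, y, ⟨hy, hyD⟩, rfl⟩
  obtain ⟨f, hf, a, ha, hfa⟩ := h (Set.add_mem_add hx hy)
  have hxy : x + y ∈ D := D.add_mem hxD hyD
  obtain ⟨hdD, a', ha', hfa'⟩ := hd f ⟨x + y, hxy, a, ha, hfa⟩
  refine ⟨d f, ⟨f, hf, rfl⟩, x + y - d f, ⟨?_, D.sub_mem hxy hdD⟩, by simp⟩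
  refine ⟨a, ha, -a', by rw [← hneg]; simpa using ha', ?_⟩
  simp only at hfa ⊢
  rw [← hfa, ← hfa']
  abel

/-- If finitely many translates of a closed symmetric set `Λ` cover `X`, then near `0` the set `X`
is contained in `Λ + Λ`. -/
theorem FinitelyCovered.eventually_mem_add {G : Type*} [AddCommGroup G] [TopologicalSpace G]
    [IsTopologicalAddGroup G] {X Λ : Set G} (h : FinitelyCovered X Λ) (hcl : IsClosed Λ)
    (hneg : -Λ = Λ) : ∀ᶠ x in 𝓝 (0 : G), x ∈ X → x ∈ Λ + Λ := by
  obtain ⟨F, hF, h⟩ := h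
  have key : ∀ f ∈ F, ∀ᶠ x in 𝓝 (0 : G), x - f ∈ Λ → x ∈ Λ + Λ := by
    intro f _
    by_cases hf : f ∈ Λ
    · exact Eventually.of_forall fun x hx => ⟨x - f, hx, f, hf, by simp⟩
    · have h1 : Tendsto (fun x : G => x - f) (𝓝 0) (𝓝 (-f)) := by
        have : Continuous fun x : G => x - f := by fun_prop
        simpa using this.tendsto 0
      have h2 : -f ∈ Λᶜ := fun h' => hf (by rw [← hneg]; exact h')
      filter_upwards [h1.eventually (hcl.isOpen_compl.mem_nhds h2)] with x hx hx'
      exact absurd hx' hx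
  filter_upwards [(eventually_all_finite hF).2 key] with x hx hxX
  obtain ⟨f, hf, a, ha, rfl⟩ := h hxX
  exact hx f hf (by simpa using ha)

/-- A closed local subgroup of a finite-dimensional space is, near `0`, a linear subspace. -/
theorem exists_submodule_eventually_mem_iff {E : Type*} [NormedAddCommGroup E] [NormedSpace ℝ E]
    [FiniteDimensional ℝ E] {L : Set E} {δ : ℝ} (hδ : 0 < δ) (hcl : IsClosed L) (h0 : (0 : E) ∈ L)
    (hneg : ∀ x ∈ L, -x ∈ L) (hadd : ∀ x ∈ L, ∀ y ∈ L, ‖x + y‖ ≤ δ → x + y ∈ L) :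
    ∃ W : Submodule ℝ E, ∀ᶠ x in 𝓝 (0 : E), x ∈ L ↔ x ∈ W := by
  have hmul : ∀ x ∈ L, ∀ k : ℕ, ‖(k : ℝ) • x‖ ≤ δ → (k : ℝ) • x ∈ L := by
    intro x hx k
    induction k with
    | zero => intro _; simpa using h0
    | succ k ih =>
      intro hk
      have hle : ‖(k : ℝ) • x‖ ≤ ‖((k + 1 : ℕ) : ℝ) • x‖ := by
        rw [norm_smul, norm_smul]
        gcongr
        simp only [Real.norm_natCast]
        exact_mod_cast Nat.le_succ k
      have e : ((k + 1 : ℕ) : ℝ) • x = (k : ℝ) • x + x := by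
        push_cast
        rw [add_smul, one_smul]
      rw [e] at hk ⊢
      exact hadd _ (ih (hle.trans (by rwa [e]))) _ hx hk
  let W : Submodule ℝ E :=
    { carrier := {v | ∀ᶠ t : ℝ in 𝓝 0, t • v ∈ L}
      zero_mem' := by simp [h0]
      add_mem' := by
        intro v w hv hw
        have hc : Tendsto (fun t : ℝ => ‖t • (v + w)‖) (𝓝 0) (𝓝 0) := by
          have : Continuous fun t : ℝ => ‖t • (v + w)‖ := by fun_prop
          simpa using this.tendsto 0
        have hv' : ∀ᶠ t : ℝ in 𝓝 0, t • v ∈ L := hv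
        have hw' : ∀ᶠ t : ℝ in 𝓝 0, t • w ∈ L := hw
        change ∀ᶠ t : ℝ in 𝓝 0, t • (v + w) ∈ L
        filter_upwards [hv', hw', hc.eventually (eventually_le_nhds hδ)] with t h1 h2 h3
        rw [smul_add] at h3 ⊢
        exact hadd _ h1 _ h2 h3
      smul_mem' := by
        intro c v hv
        have hc : Tendsto (fun t : ℝ => t * c) (𝓝 0) (𝓝 0) := by
          have : Continuous fun t : ℝ => t * c := by fun_prop
          simpa using this.tendsto 0
        have hv' : ∀ᶠ t : ℝ in 𝓝 0, t • v ∈ L := hv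
        change ∀ᶠ t : ℝ in 𝓝 0, t • c • v ∈ L
        filter_upwards [hc.eventually hv'] with t ht
        rwa [smul_smul] }
  have hWL : ∀ v ∈ W, ‖v‖ ≤ δ → v ∈ L := by
    intro v hv hvδ
    have hv' : ∀ᶠ t : ℝ in 𝓝 0, t • v ∈ L := hv
    have hlim : Tendsto (fun k : ℕ => 1 / ((k : ℝ) + 1)) atTop (𝓝 0) :=
      tendsto_one_div_add_atTop_nhds_zero_nat
    obtain ⟨k, hk⟩ := (hlim.eventually hv').exists
    have e : ((k + 1 : ℕ) : ℝ) • (1 / ((k : ℝ) + 1)) • v = v := by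
      rw [smul_smul]
      push_cast
      rw [mul_one_div_cancel (by positivity), one_smul]
    have := hmul _ hk (k + 1)
    rw [e] at this
    exact this hvδ
  obtain ⟨p, hp⟩ := W.subtype.exists_leftInverse_of_injective W.ker_subtype
  have hpW : ∀ w (hw : w ∈ W), p w = ⟨w, hw⟩ := fun w hw => LinearMap.congr_fun hp ⟨w, hw⟩
  have hpc : Continuous p := p.continuous_of_finiteDimensional
  let q : E → E := fun x => x - (p x : E)
  have hqc : Continuous q := by fun_prop
  have hq0 : q 0 = 0 := by simp [q]
  have hpq : ∀ x, p (q x) = 0 := by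
    intro x
    simp only [q, map_sub]
    rw [hpW (p x : E) (p x).2]
    simp
  have hqL : ∀ᶠ x in 𝓝 (0 : E), x ∈ L → q x ∈ L := by
    have h1 : Tendsto (fun x => ‖(p x : E)‖) (𝓝 0) (𝓝 0) := by
      have : Continuous fun x => ‖(p x : E)‖ := by fun_prop
      simpa using this.tendsto 0
    have h2 : Tendsto (fun x => ‖q x‖) (𝓝 0) (𝓝 0) := by
      simpa [hq0] using hqc.norm.tendsto 0
    filter_upwards [h1.eventually (eventually_le_nhds hδ),
      h2.eventually (eventually_le_nhds hδ)] with x hx1 hx2 hx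
    have := hadd x hx _ (hneg _ (hWL _ (p x).2 hx1))
    rw [← sub_eq_add_neg] at this
    exact this hx2
  -- Small nonzero elements of `L ∩ ker p` would accumulate to a direction in `W ∩ ker p`.
  have hker : ∀ᶠ u in 𝓝 (0 : E), u ∈ L → p u = 0 → u = 0 := by
    by_contra hcon
    have hfr : ∃ᶠ u in 𝓝 (0 : E), u ∈ L ∧ p u = 0 ∧ u ≠ 0 := by
      refine (not_eventually.1 hcon).mono fun u hu => ?_
      push Not at hu
      exact hu
    obtain ⟨u, hu0, hu⟩ := exists_seq_forall_of_frequently hfr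
    have hmem : ∀ k, ‖u k‖⁻¹ • u k ∈ Metric.sphere (0 : E) 1 := by
      intro k
      have : ‖u k‖ ≠ 0 := norm_ne_zero_iff.2 (hu k).2.2
      simp [norm_smul, this]
    obtain ⟨v, hv, φ, hφ, hlim⟩ := (isCompact_sphere (0 : E) 1).tendsto_subseq hmem
    have hv1 : ‖v‖ = 1 := by simpa using hv
    have hnorm0 : Tendsto (fun k => ‖u (φ k)‖) atTop (𝓝 0) := by
      simpa using (hu0.comp hφ.tendsto_atTop).norm
    have hpv : p v = 0 := by
      have h1 := (hpc.tendsto v).comp hlim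
      refine tendsto_nhds_unique h1 (tendsto_const_nhds.congr fun k => ?_)
      simp [(hu (φ k)).2.1]
    have hpos : ∀ t : ℝ, 0 ≤ t → t ≤ δ → t • v ∈ L := by
      intro t ht htδ
      have hfl : Tendsto (fun k => (⌊t / ‖u (φ k)‖⌋₊ : ℝ) * ‖u (φ k)‖) atTop (𝓝 t) := by
        have hlow : Tendsto (fun k => t - ‖u (φ k)‖) atTop (𝓝 t) := by
          simpa using tendsto_const_nhds.sub hnorm0
        refine tendsto_of_tendsto_of_tendsto_of_le_of_le hlow tendsto_const_nhds ?_ ?_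
        · intro k
          have hk : 0 < ‖u (φ k)‖ := norm_pos_iff.2 (hu (φ k)).2.2
          have := (div_lt_iff₀ hk).1 (Nat.lt_floor_add_one (t / ‖u (φ k)‖))
          simp only
          linarith
        · intro k
          have hk : 0 < ‖u (φ k)‖ := norm_pos_iff.2 (hu (φ k)).2.2
          exact (le_div_iff₀ hk).1 (Nat.floor_le (by positivity))
      refine hcl.mem_of_tendsto (hfl.smul hlim) (Eventually.of_forall fun k => ?_)
      have hk : 0 < ‖u (φ k)‖ := norm_pos_iff.2 (hu (φ k)).2.2
      have e : ((⌊t / ‖u (φ k)‖⌋₊ : ℝ) * ‖u (φ k)‖) • ((fun k => ‖u k‖⁻¹ • u k) ∘ φ) k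
          = (⌊t / ‖u (φ k)‖⌋₊ : ℝ) • u (φ k) := by
        simp only [Function.comp, smul_smul]
        congr 1
        field_simp
      rw [e]
      refine hmul _ (hu (φ k)).1 _ ?_
      rw [norm_smul, Real.norm_natCast]
      exact ((le_div_iff₀ hk).1 (Nat.floor_le (by positivity))).trans htδ
    have hvW : v ∈ W := by
      change ∀ᶠ t : ℝ in 𝓝 0, t • v ∈ L
      filter_upwards [eventually_le_nhds hδ, eventually_ge_nhds (neg_lt_zero.2 hδ)] with t h1 h2
      rcases le_total 0 t with h | h
      · exact hpos t h h1
      · have := hneg _ (hpos (-t) (by linarith) (by linarith))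
        simpa using this
    rw [hpW v hvW] at hpv
    have : v = 0 := congrArg Subtype.val hpv
    simp [this] at hv1
  refine ⟨W, ?_⟩
  have hq_tendsto : Tendsto q (𝓝 0) (𝓝 0) := by simpa [hq0] using hqc.tendsto 0
  filter_upwards [hqL, hq_tendsto.eventually hker, Metric.closedBall_mem_nhds (0 : E) hδ]
    with x h1 h2 h3
  refine ⟨fun hx => ?_, fun hx => hWL x hx (by simpa using h3)⟩
  have : x = (p x : E) := sub_eq_zero.1 (h2 (h1 hx) (hpq x))
  rw [this]
  exact (p x).2

/-- The square of a closed approximate subgroup of a finite-dimensional space coincides near `0`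
with a linear subspace. -/
theorem IsAddApproxSubgroup.exists_submodule_eventually_mem_iff {E : Type*} [NormedAddCommGroup E]
    [NormedSpace ℝ E] [FiniteDimensional ℝ E] {Λ : Set E} (hΛ : IsAddApproxSubgroup Λ)
    (hcl : IsClosed Λ) : ∃ W : Submodule ℝ E, ∀ᶠ x in 𝓝 (0 : E), x ∈ Λ + Λ ↔ x ∈ W := by
  obtain ⟨hneg, h0, hΛΛ⟩ := isAddApproxSubgroup_iff_finitelyCovered.1 hΛ
  obtain ⟨F, hF, hcov⟩ := id hΛΛ
  have hMcl : IsClosed (F + Λ) := hcl.add_left_of_isCompact hF.isCompact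
  have hM : FinitelyCovered (F + Λ) Λ := ⟨F, hF, subset_rfl⟩
  have hnear := (hM.eventually_mem_add hcl hneg).and
    ((hΛΛ.add hΛΛ hΛΛ).eventually_mem_add hcl hneg)
  obtain ⟨δ, hδ, hball⟩ := Metric.nhds_basis_closedBall.eventually_iff.1 hnear
  have hL : (Λ + Λ) ∩ Metric.closedBall 0 δ = (F + Λ) ∩ Metric.closedBall 0 δ := by
    ext x
    exact ⟨fun hx => ⟨hcov hx.1, hx.2⟩, fun hx => ⟨(hball hx.2).1 hx.1, hx.2⟩⟩
  obtain ⟨W, hW⟩ := _root_.exists_submodule_eventually_mem_iff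
    (L := (Λ + Λ) ∩ Metric.closedBall 0 δ) hδ
    (hL ▸ hMcl.inter Metric.isClosed_closedBall)
    ⟨⟨0, h0, 0, h0, add_zero 0⟩, Metric.mem_closedBall_self hδ.le⟩
    (fun x hx => ⟨by
      have := Set.neg_mem_neg.2 hx.1
      rwa [neg_add, hneg] at this, by simpa using hx.2⟩)
    (fun x hx y hy hxy => by
      have hmem : x + y ∈ Metric.closedBall (0 : E) δ := by simpa using hxy
      exact ⟨(hball hmem).2 (Set.add_mem_add hx.1 hy.1), hmem⟩)
  refine ⟨W, ?_⟩
  filter_upwards [hW, Metric.closedBall_mem_nhds (0 : E) hδ] with x hx hxδ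
  rw [← hx]
  exact ⟨fun h => ⟨h, hxδ⟩, fun h => h.1⟩

/-- A compact subset of a subspace is covered by finitely many translates of any set containing a
neighbourhood of `0` in that subspace. -/
theorem IsCompact.finitelyCovered_of_eventually_mem {E : Type*} [NormedAddCommGroup E]
    [NormedSpace ℝ E] {W : Submodule ℝ E} {C S : Set E} (hC : IsCompact C) (hCW : C ⊆ W)
    (hS : ∀ᶠ x in 𝓝 (0 : E), x ∈ W → x ∈ S) : FinitelyCovered C S := by
  obtain ⟨ε, hε, hball⟩ := Metric.eventually_nhds_iff_ball.1 hS
  obtain ⟨t, htC, ht, hcov⟩ := hC.finite_cover_balls hε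
  refine ⟨t, ht, fun x hx => ?_⟩
  obtain ⟨y, hy, hxy⟩ := Set.mem_iUnion₂.1 (hcov hx)
  refine ⟨y, hy, x - y, hball _ ?_ (W.sub_mem (hCW hx) (hCW (htC hy))), by simp⟩
  simpa [dist_eq_norm] using hxy

theorem closed_approximate_subgroups_of_euclidean_space (n : ℕ)
    (Λ : Set (Fin n → ℝ)) (hΛ : IsAddApproxSubgroup Λ) (hcl : IsClosed Λ) :
    ∃ Vo Vd : Submodule ℝ (Fin n → ℝ), IsCompl Vo Vd ∧
      ∃ Λd K : Set (Fin n → ℝ),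
        Λd ⊆ (Vd : Set (Fin n → ℝ)) ∧ K ⊆ (Vd : Set (Fin n → ℝ)) ∧
        IsAddApproxSubgroup Λd ∧
        (∃ V ∈ nhds (0 : Fin n → ℝ), (Λd - Λd) ∩ V = {0}) ∧
        IsAddApproxSubgroup K ∧ IsCompact K ∧
        AreAddCommensurable Λ ((Vo : Set (Fin n → ℝ)) + Λd + K) := by
  obtain ⟨hneg, h0, hΛΛ⟩ := isAddApproxSubgroup_iff_finitelyCovered.1 hΛ
  obtain ⟨W, hW⟩ := hΛ.exists_submodule_eventually_mem_iff hcl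
  obtain ⟨p, hp⟩ := W.subtype.exists_leftInverse_of_injective W.ker_subtype
  have hpW : ∀ w : W, p (w : Fin n → ℝ) = w := fun w => LinearMap.congr_fun hp w
  let b := Module.finBasis ℝ W
  let r : ℝ := ∑ i, ‖b i‖
  have hr : 0 ≤ r := Finset.sum_nonneg fun i _ => norm_nonneg _
  let C : Set (Fin n → ℝ) := (W : Set (Fin n → ℝ)) ∩ Metric.closedBall 0 (r + 1)
  have hCW : C ⊆ W := Set.inter_subset_left
  have hC : IsCompact C :=
    (isCompact_closedBall 0 (r + 1)).inter_left W.closed_of_finiteDimensional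
  have hC0 : (0 : Fin n → ℝ) ∈ C := ⟨W.zero_mem, Metric.mem_closedBall_self (by positivity)⟩
  have hCneg : -C = C := by
    ext x
    simp [C]
  have hCnear : ∀ᶠ x in 𝓝 (0 : Fin n → ℝ), x ∈ W → x ∈ C := by
    filter_upwards [Metric.closedBall_mem_nhds (0 : Fin n → ℝ) (by positivity : 0 < r + 1)]
      with x hx hxW
    exact ⟨hxW, hx⟩
  have hCap : IsAddApproxSubgroup C := by
    refine isAddApproxSubgroup_iff_finitelyCovered.2 ⟨hCneg, hC0, ?_⟩
    refine (hC.add hC).finitelyCovered_of_eventually_mem ?_ hCnear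
    rintro _ ⟨x, hx, y, hy, rfl⟩
    exact W.add_mem (hCW hx) (hCW hy)
  have hCΛ : FinitelyCovered C Λ :=
    (hC.finitelyCovered_of_eventually_mem hCW (hW.mono fun x hx => hx.2)).trans hΛΛ
  have hAΛ : FinitelyCovered (Λ + C) Λ := hΛΛ.add (.of_subset subset_rfl) hCΛ
  have hΛA : Λ ⊆ Λ + C := Set.subset_add_left Λ hC0
  have hA : IsAddApproxSubgroup (Λ + C) := by
    refine isAddApproxSubgroup_iff_finitelyCovered.2 ⟨by rw [neg_add, hneg, hCneg], hΛA h0, ?_⟩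
    exact (hΛΛ.add hAΛ hAΛ).trans (.of_subset hΛA)
  have hAA : FinitelyCovered (Λ + C + (Λ + C)) Λ := hΛΛ.add hAΛ hAΛ
  let Z : Submodule ℤ W := Submodule.span ℤ (Set.range b)
  let D : AddSubgroup (Fin n → ℝ) := Z.toAddSubgroup.comap p.toAddMonoidHom
  have hmemD : ∀ x, x ∈ D ↔ p x ∈ Z := fun x => Iff.rfl
  have hZ : ∀ᶠ w in 𝓝 (0 : W), w ∈ Z → w = 0 := by
    have hd : DiscreteTopology Z := inferInstanceAs
      (DiscreteTopology (Submodule.span ℤ (Set.range b)))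
    obtain ⟨U, hU, hUZ⟩ := (mem_nhds_induced ((↑) : Z → W) 0 {0}).1 (by
      simpa only [← nhds_induced] using (isOpen_discrete ({0} : Set Z)).mem_nhds rfl)
    filter_upwards [hU] with w hw hwZ
    exact congrArg Subtype.val (hUZ (show (⟨w, hwZ⟩ : Z) ∈ _ from hw))
  have hp0 : Tendsto p (𝓝 0) (𝓝 0) := by
    simpa using p.continuous_of_finiteDimensional.tendsto 0
  refine ⟨⊥, ⊤, isCompl_bot_top, (Λ + C + (Λ + C)) ∩ D, C, by simp, by simp,
    hA.add_self_inter D, ?_, hCap, hC, ?_⟩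
  · refine ⟨{x | x ∈ (Λ + C + (Λ + C)) ∩ D - (Λ + C + (Λ + C)) ∩ D → x = 0}, ?_, ?_⟩
    · filter_upwards [(hΛΛ.add hAA hAA).eventually_mem_add hcl hneg, hW, hp0.eventually hZ]
        with x h1 h2 h3
      rintro ⟨y, ⟨hy, hyD⟩, z, ⟨hz, hzD⟩, rfl⟩
      have hzn : -z ∈ Λ + C + (Λ + C) := by
        have := Set.neg_mem_neg.2 hz
        rwa [neg_add, neg_add, hneg, hCneg] at this
      have hW' : y - z ∈ W := h2.1 (h1 (by
        simpa only [sub_eq_add_neg] using Set.add_mem_add hy hzn))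
      have := h3 ((hmemD _).1 (D.sub_mem hyD hzD))
      have e := hpW ⟨y - z, hW'⟩
      simp only at this e ⊢
      rw [this] at e
      exact (congrArg Subtype.val e).symm
    · ext x
      refine ⟨fun hx => hx.2 hx.1, ?_⟩
      rintro rfl
      have hmem := (hA.add_self_inter D).2.1
      exact ⟨⟨0, hmem, 0, hmem, sub_zero 0⟩, fun _ => rfl⟩
  · have hsub : Λ ⊆ (Λ + C + (Λ + C)) ∩ D + C := by
      intro x hx
      have hfr : ((ZSpan.fract b (p x) : W) : Fin n → ℝ) ∈ C := by
        refine ⟨(ZSpan.fract b (p x)).2, ?_⟩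
        have := ZSpan.norm_fract_le b (p x)
        rw [mem_closedBall_zero_iff]
        exact this.trans (by simp [r])
      refine ⟨x - ((ZSpan.fract b (p x) : W) : Fin n → ℝ), ⟨?_, ?_⟩, _, hfr, by simp⟩
      · refine Set.subset_add_left _ (hΛA h0) ?_
        rw [sub_eq_add_neg]
        exact Set.add_mem_add hx (by rw [← hCneg]; simpa using hfr)
      · change x - ((ZSpan.fract b (p x) : W) : Fin n → ℝ) ∈ D
        rw [hmemD, map_sub, hpW, ZSpan.fract_apply, sub_sub_cancel]
        exact (ZSpan.floor b (p x)).2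
    obtain ⟨F, hF, hcov⟩ := hΛΛ.add
      (FinitelyCovered.trans (.of_subset (Set.inter_subset_left (t := (D : Set (Fin n → ℝ)))))
        hAA) hCΛ
    refine ⟨(hF.insert 0).toFinset, ?_, ?_⟩
    · simp only [Set.Finite.coe_toFinset, Submodule.bot_coe, Set.singleton_zero, zero_add]
      exact hsub.trans (Set.subset_add_right _ (Set.mem_insert 0 F))
    · simp only [Set.Finite.coe_toFinset, Submodule.bot_coe, Set.singleton_zero, zero_add]
      exact hcov.trans (Set.add_subset_add_right (Set.subset_insert 0 F))
end

section
/- Let Λ be a closed approximate subgroup of ℝ (with addition). Then exactly one of the following holds: (1) Λ is finite; (2) there are real numbers 0 < a < b < ∞ such that [−a, a] ⊆ Λ + Λ ⊆ [−b, b]; (3) Λ is uniformly discrete and relatively dense in ℝ (i.e. there is a compact K ⊆ ℝ with Λ + K = ℝ); (4) there is n ∈ ℕ such that the n-fold sumset Λ + Λ + … + Λ equals ℝ. In particular, Λ is uniformly discrete or Λ has non-empty interior. -/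
open Pointwise

/-- The `m`-fold sumset of `Λ`. -/
def iterSum (Λ : Set ℝ) : ℕ → Set ℝ
  | 0 => {0}
  | m + 1 => iterSum Λ m + Λ

/-- `Λ` is uniformly discrete in `ℝ`. -/
def UnifDiscrete (Λ : Set ℝ) : Prop := ∃ V ∈ nhds (0 : ℝ), (Λ - Λ) ∩ V = {0}

/-- Case (1): `Λ` is finite. -/
def CaseFin (Λ : Set ℝ) : Prop := Λ.Finite

/-- Case (2): `Λ + Λ` is wedged between two symmetric intervals. -/
def CaseInt (Λ : Set ℝ) : Prop :=
  ∃ a b : ℝ, 0 < a ∧ a < b ∧ Set.Icc (-a) a ⊆ Λ + Λ ∧ Λ + Λ ⊆ Set.Icc (-b) b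

/-- Case (3): `Λ` is a uniform approximate lattice in `ℝ`. -/
def CaseLat (Λ : Set ℝ) : Prop :=
  UnifDiscrete Λ ∧ ∃ K : Set ℝ, IsCompact K ∧ Λ + K = Set.univ

/-- Case (4): some iterated sumset of `Λ` is all of `ℝ`. -/
def CaseAll (Λ : Set ℝ) : Prop := ∃ m : ℕ, iterSum Λ m = Set.univ

open Set

namespace IsAddApproxSubgroup

theorem neg_mem {G : Type*} [AddGroup G] {Λ : Set G} (hΛ : IsAddApproxSubgroup Λ) {x : G}
    (hx : x ∈ Λ) : -x ∈ Λ := by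
  rw [← hΛ.1]
  simpa using hx

theorem sub_eq_add {G : Type*} [AddGroup G] {Λ : Set G} (hΛ : IsAddApproxSubgroup Λ) :
    Λ - Λ = Λ + Λ := by
  rw [sub_eq_add_neg, hΛ.1]

theorem neg_mem_add {G : Type*} [AddCommGroup G] {Λ : Set G} (hΛ : IsAddApproxSubgroup Λ) {x : G}
    (hx : x ∈ Λ + Λ) : -x ∈ Λ + Λ := by
  obtain ⟨y, hy, z, hz, rfl⟩ := hx
  exact ⟨-y, hΛ.neg_mem hy, -z, hΛ.neg_mem hz, by simp only [neg_add]⟩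

end IsAddApproxSubgroup

theorem unifDiscrete_iff {Λ : Set ℝ} (h0 : (0 : ℝ) ∈ Λ) :
    UnifDiscrete Λ ↔ ∃ ε > 0, ∀ x ∈ Λ, ∀ y ∈ Λ, |x - y| < ε → x = y := by
  constructor
  · rintro ⟨V, hV, h⟩
    obtain ⟨ε, hε, hb⟩ := Metric.mem_nhds_iff.1 hV
    refine ⟨ε, hε, fun x hx y hy hxy => ?_⟩
    have hmem : x - y ∈ (Λ - Λ) ∩ V :=
      ⟨sub_mem_sub hx hy, hb (by simpa [Real.dist_eq] using hxy)⟩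
    rw [h] at hmem
    exact sub_eq_zero.1 hmem
  · rintro ⟨ε, hε, h⟩
    refine ⟨Metric.ball 0 ε, Metric.ball_mem_nhds _ hε, Subset.antisymm ?_ ?_⟩
    · rintro _ ⟨⟨x, hx, y, hy, rfl⟩, hb⟩
      exact sub_eq_zero.2 (h x hx y hy (by simpa [Real.dist_eq] using hb))
    · rintro _ rfl
      exact ⟨⟨0, h0, 0, h0, sub_zero 0⟩, Metric.mem_ball_self hε⟩

theorem injOn_floor_div_of_separated {Λ : Set ℝ} {ε : ℝ} (hε : 0 < ε)
    (h : ∀ x ∈ Λ, ∀ y ∈ Λ, |x - y| < ε → x = y) : InjOn (fun x : ℝ => ⌊x / ε⌋) Λ := by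
  intro x hx y hy hxy
  apply h x hx y hy
  have := Int.abs_sub_lt_one_of_floor_eq_floor hxy
  rwa [← sub_div, abs_div, abs_of_pos hε, div_lt_one hε] at this

theorem UnifDiscrete.countable {Λ : Set ℝ} (h0 : (0 : ℝ) ∈ Λ) (h : UnifDiscrete Λ) :
    Λ.Countable := by
  obtain ⟨ε, hε, h⟩ := (unifDiscrete_iff h0).1 h
  exact countable_of_injective_of_countable_image (injOn_floor_div_of_separated hε h)
    (to_countable _)

theorem UnifDiscrete.finite_of_isBounded {Λ : Set ℝ} (h0 : (0 : ℝ) ∈ Λ) (h : UnifDiscrete Λ)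
    (hb : Bornology.IsBounded Λ) : Λ.Finite := by
  obtain ⟨ε, hε, h⟩ := (unifDiscrete_iff h0).1 h
  obtain ⟨R, hR⟩ := isBounded_iff_forall_norm_le.1 hb
  refine Finite.of_injOn (t := Icc ⌊-R / ε⌋ ⌊R / ε⌋) (fun x hx => ?_)
    (injOn_floor_div_of_separated hε h) (finite_Icc _ _)
  have := abs_le.1 (hR x hx)
  exact ⟨Int.floor_le_floor (by gcongr; exact this.1), Int.floor_le_floor (by gcongr; exact this.2)⟩

theorem interior_finset_add_eq_empty {Λ : Set ℝ} (hcl : IsClosed Λ) (hint : interior Λ = ∅)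
    (F : Finset ℝ) : interior ((F : Set ℝ) + Λ) = ∅ := by
  induction F using Finset.induction_on with
  | empty => simp
  | insert f F _ ih =>
    have hvadd : interior ({f} + Λ) = ∅ := by
      rw [singleton_add, image_add_left]
      have := (Homeomorph.addLeft (-f)).preimage_interior Λ
      rw [hint, preimage_empty] at this
      exact this.symm
    rw [Finset.coe_insert, insert_eq, union_add,
      interior_union_isClosed_of_interior_empty (hcl.add_left_of_isCompact isCompact_singleton) ih, hvadd]

theorem IsAddApproxSubgroup.exists_small_mem_add {Λ : Set ℝ} (hΛ : IsAddApproxSubgroup Λ)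
    (hcl : IsClosed Λ) :
    ∃ δ > 0, ∀ x ∈ Λ + Λ, ∀ y ∈ Λ + Λ, |x + y| ≤ δ → x + y ∈ Λ + Λ := by
  obtain ⟨F, hF⟩ := hΛ.2.2
  have hcover : ∀ e ∈ F + F + F, ∀ᶠ z in nhds (0 : ℝ), z - e ∈ Λ → e ∈ Λ := by
    intro e _
    by_cases he : e ∈ Λ
    · exact Filter.Eventually.of_forall fun _ _ => he
    · have hne : (0 : ℝ) - e ∈ Λᶜ := fun hmem => he (by simpa using hΛ.neg_mem hmem)
      have hcont : ContinuousAt (fun z : ℝ => z - e) 0 := by fun_prop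
      filter_upwards [hcont.eventually (hcl.isOpen_compl.mem_nhds hne)] with z hz hz'
      exact absurd hz' hz
  obtain ⟨δ, hδ, h⟩ := Metric.eventually_nhds_iff.1 ((Finset.eventually_all _).2 hcover)
  refine ⟨δ / 2, half_pos hδ, fun x hx y hy hxy => ?_⟩
  obtain ⟨f, hf, u, hu, rfl⟩ := hF hx
  obtain ⟨g, hg, v, hv, rfl⟩ := hF hy
  obtain ⟨k, hk, w, hw, huv⟩ := hF (add_mem_add hu hv)
  have huv' : k + w = u + v := huv
  have he : f + g + k ∈ F + F + F := Finset.add_mem_add (Finset.add_mem_add hf hg) hk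
  have hz : f + u + (g + v) - (f + g + k) = w := by linarith
  refine ⟨f + g + k, h (y := f + u + (g + v)) ?_ _ he ?_, w, hw, ?_⟩
  · rw [Real.dist_eq, sub_zero]
    exact hxy.trans_lt (half_lt_self hδ)
  · rwa [hz]
  · change f + g + k + w = f + u + (g + v)
    linarith

theorem IsAddApproxSubgroup.exists_small_pos {Λ : Set ℝ} (hΛ : IsAddApproxSubgroup Λ)
    (hud : ¬ UnifDiscrete Λ) {ε : ℝ} (hε : 0 < ε) : ∃ x ∈ Λ + Λ, 0 < x ∧ x < ε := by
  rw [unifDiscrete_iff hΛ.2.1] at hud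
  push Not at hud
  obtain ⟨x, hx, y, hy, hlt, hne⟩ := hud ε hε
  have hmem : x - y ∈ Λ + Λ := hΛ.sub_eq_add ▸ sub_mem_sub hx hy
  refine ⟨|x - y|, ?_, abs_pos.2 (sub_ne_zero.2 hne), hlt⟩
  rcases abs_choice (x - y) with h | h <;> rw [h]
  exacts [hmem, hΛ.neg_mem_add hmem]

/-- A closed approximate subgroup of the line that is not uniformly discrete has interior:
short multiples of small elements of `Λ + Λ` stay in `Λ + Λ`, which is therefore dense near `0`. -/
theorem IsAddApproxSubgroup.interior_nonempty {Λ : Set ℝ} (hΛ : IsAddApproxSubgroup Λ)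
    (hcl : IsClosed Λ) (hud : ¬ UnifDiscrete Λ) : (interior Λ).Nonempty := by
  obtain ⟨δ, hδ, hadd⟩ := hΛ.exists_small_mem_add hcl
  have hmul : ∀ x ∈ Λ + Λ, 0 < x → ∀ j : ℕ, j * x ≤ δ → (j : ℝ) * x ∈ Λ + Λ := by
    intro x hx hpos j
    induction j with
    | zero => exact fun _ => ⟨0, hΛ.2.1, 0, hΛ.2.1, by simp⟩
    | succ j ih =>
      intro hj
      have hsucc : ((j + 1 : ℕ) : ℝ) * x = j * x + x := by push_cast; ring
      rw [hsucc] at hj ⊢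
      refine hadd _ (ih (by linarith)) _ hx ?_
      rwa [abs_of_nonneg (by positivity)]
  have hdense : Ioo 0 δ ⊆ closure (Λ + Λ) := by
    intro t ht
    refine Metric.mem_closure_iff.2 fun ε hε => ?_
    obtain ⟨x, hx, hpos, hlt⟩ := hΛ.exists_small_pos hud hε
    have hle : (⌊t / x⌋₊ : ℝ) * x ≤ t :=
      (le_div_iff₀ hpos).1 (Nat.floor_le (div_nonneg ht.1.le hpos.le))
    have hlt' : t < (⌊t / x⌋₊ + 1 : ℝ) * x := (div_lt_iff₀ hpos).1 (Nat.lt_floor_add_one _)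
    refine ⟨_, hmul x hx hpos ⌊t / x⌋₊ (hle.trans ht.2.le), ?_⟩
    rw [Real.dist_eq, abs_of_nonneg (by linarith)]
    linarith
  obtain ⟨F, hF⟩ := hΛ.2.2
  by_contra hne
  have hempty := interior_finset_add_eq_empty hcl (not_nonempty_iff_eq_empty.1 hne) F
  have hclosed : IsClosed ((F : Set ℝ) + Λ) :=
    hcl.add_left_of_isCompact F.finite_toSet.isCompact
  have hmem : δ / 2 ∈ interior ((F : Set ℝ) + Λ) :=
    interior_maximal (hdense.trans (closure_minimal hF hclosed)) isOpen_Ioo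
      ⟨half_pos hδ, half_lt_self hδ⟩
  simp [hempty] at hmem

theorem IsAddApproxSubgroup.exists_Icc_subset_add {Λ : Set ℝ} (hΛ : IsAddApproxSubgroup Λ)
    (hint : (interior Λ).Nonempty) : ∃ a > 0, Icc (-a) a ⊆ Λ + Λ := by
  obtain ⟨p, hp⟩ := hint
  obtain ⟨ε, hε, hb⟩ := Metric.mem_nhds_iff.1 (mem_interior_iff_mem_nhds.1 hp)
  refine ⟨ε / 2, half_pos hε, fun t ht => ⟨p + t, hb ?_, -p, hΛ.neg_mem (interior_subset hp), ?_⟩⟩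
  · rw [Metric.mem_ball, Real.dist_eq, add_sub_cancel_left]
    exact (abs_le.2 ht).trans_lt (half_lt_self hε)
  · simp

theorem IsAddApproxSubgroup.exists_add_Icc_eq_univ {Λ : Set ℝ} (hΛ : IsAddApproxSubgroup Λ)
    (hb : ¬ Bornology.IsBounded Λ) : ∃ R : ℝ, Λ + Icc (-R) R = univ := by
  obtain ⟨F, hF⟩ := hΛ.2.2
  obtain ⟨M, hM⟩ := isBounded_iff_forall_norm_le.1 F.finite_toSet.isBounded
  have hlarge : ∃ x ∈ Λ, M + 1 < x := by
    by_contra! hle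
    refine hb (isBounded_iff_forall_norm_le.2 ⟨M + 1, fun x hx => abs_le.2 ⟨?_, hle x hx⟩⟩)
    linarith [hle _ (hΛ.neg_mem hx)]
  obtain ⟨x, hx, hxM⟩ := hlarge
  have hstep : ∀ y ∈ Λ, ∃ z ∈ Λ, y + 1 ≤ z ∧ z ≤ y + (x + M) := by
    intro y hy
    obtain ⟨f, hf, z, hz, hfz⟩ := hF (add_mem_add hy hx)
    have hfz' : f + z = y + x := hfz
    have := abs_le.1 (hM f hf)
    exact ⟨z, hz, by linarith, by linarith⟩
  have hnear : ∀ n : ℕ, ∀ t : ℝ, 0 ≤ t → t ≤ n → ∃ y ∈ Λ, y ≤ t ∧ t ≤ y + (x + M) := by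
    have hiter : ∀ n : ℕ, ∀ t : ℝ, 0 ≤ t →
        ∃ y ∈ Λ, y ≤ t ∧ (t ≤ y + (x + M) ∨ (n : ℝ) ≤ y) := by
      intro n t ht
      induction n with
      | zero => exact ⟨0, hΛ.2.1, ht, Or.inr (by simp)⟩
      | succ n ih =>
        obtain ⟨y, hy, hyt, hty | hny⟩ := ih
        · exact ⟨y, hy, hyt, Or.inl hty⟩
        · obtain ⟨z, hz, h1, h2⟩ := hstep y hy
          rcases le_total z t with hzt | htz
          · exact ⟨z, hz, hzt, Or.inr (by push_cast; linarith)⟩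
          · exact ⟨y, hy, hyt, Or.inl (by linarith)⟩
    intro n t ht htn
    obtain ⟨y, hy, hyt, hty | hny⟩ := hiter n t ht
    · exact ⟨y, hy, hyt, hty⟩
    · obtain ⟨z, _, h1, h2⟩ := hstep y hy
      exact ⟨y, hy, hyt, by linarith⟩
  refine ⟨x + M, eq_univ_of_forall fun t => ?_⟩
  obtain ⟨n, hn⟩ := exists_nat_ge |t|
  obtain ⟨y, hy, h1, h2⟩ := hnear n |t| (abs_nonneg t) hn
  rcases abs_choice t with h | h <;> rw [h] at h1 h2
  · exact ⟨y, hy, t - y, ⟨by linarith, by linarith⟩, by simp⟩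
  · exact ⟨-y, hΛ.neg_mem hy, t + y, ⟨by linarith, by linarith⟩, by simp⟩

theorem Icc_subset_iterSum {Λ : Set ℝ} {a : ℝ} (h : Icc (-a) a ⊆ Λ + Λ) (n : ℕ) :
    Icc (-(n * a)) (n * a) ⊆ iterSum Λ (2 * n) := by
  induction n with
  | zero =>
    intro t ht
    have : t = 0 := by simpa using ht
    simpa [iterSum] using this
  | succ n ih =>
    intro t ht
    have hpos : (0 : ℝ) < n + 1 := by positivity
    push_cast at ht
    have hs : t / (n + 1) ∈ Icc (-a) a :=
      ⟨by rw [le_div_iff₀ hpos]; linarith [ht.1], by rw [div_le_iff₀ hpos]; linarith [ht.2]⟩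
    have hns : n * (t / (n + 1)) ∈ Icc (-(n * a)) (n * a) := by
      have hn : (0 : ℝ) ≤ n := n.cast_nonneg
      exact ⟨by linarith [mul_le_mul_of_nonneg_left hs.1 hn], mul_le_mul_of_nonneg_left hs.2 hn⟩
    have hsum : t = n * (t / (n + 1)) + t / (n + 1) := by field_simp
    change t ∈ iterSum Λ (2 * n) + Λ + Λ
    rw [add_assoc, hsum]
    exact add_mem_add (ih hns) (h hs)

theorem isBounded_iterSum {Λ : Set ℝ} (h : Bornology.IsBounded Λ) (m : ℕ) :
    Bornology.IsBounded (iterSum Λ m) := by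
  induction m with
  | zero => exact Bornology.isBounded_singleton
  | succ m ih => exact ih.add h

theorem countable_iterSum {Λ : Set ℝ} (h : Λ.Countable) (m : ℕ) : (iterSum Λ m).Countable := by
  induction m with
  | zero => exact countable_singleton 0
  | succ m ih => exact ih.image2 h _

theorem CaseInt.isBounded {Λ : Set ℝ} (h0 : (0 : ℝ) ∈ Λ) (h : CaseInt Λ) :
    Bornology.IsBounded Λ := by
  obtain ⟨a, b, _, _, _, hb⟩ := h
  exact (Metric.isBounded_Icc (-b) b).subset
    fun x hx => hb ⟨x, hx, 0, h0, add_zero x⟩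

theorem CaseLat.not_isBounded {Λ : Set ℝ} (h : CaseLat Λ) : ¬ Bornology.IsBounded Λ := by
  obtain ⟨_, K, hK, hu⟩ := h
  exact fun hb => NoncompactSpace.noncompact_univ (X := ℝ)
    (Metric.isCompact_of_isClosed_isBounded isClosed_univ (hu ▸ hb.add hK.isBounded))

theorem CaseAll.not_isBounded {Λ : Set ℝ} (h : CaseAll Λ) : ¬ Bornology.IsBounded Λ := by
  obtain ⟨m, hm⟩ := h
  exact fun hb => NoncompactSpace.noncompact_univ (X := ℝ)
    (Metric.isCompact_of_isClosed_isBounded isClosed_univ (hm ▸ isBounded_iterSum hb m))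

theorem IsAddApproxSubgroup.caseAll {Λ : Set ℝ} (hΛ : IsAddApproxSubgroup Λ)
    (hint : (interior Λ).Nonempty) (hb : ¬ Bornology.IsBounded Λ) : CaseAll Λ := by
  obtain ⟨a, ha, hsub⟩ := hΛ.exists_Icc_subset_add hint
  obtain ⟨R, hR⟩ := hΛ.exists_add_Icc_eq_univ hb
  obtain ⟨n, hn⟩ := exists_nat_ge (R / a)
  rw [div_le_iff₀ ha] at hn
  refine ⟨2 * n + 1, univ_subset_iff.1 ?_⟩
  change univ ⊆ iterSum Λ (2 * n) + Λ
  rw [← hR, add_comm Λ]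
  exact add_subset_add_right ((Icc_subset_Icc (neg_le_neg hn) hn).trans (Icc_subset_iterSum hsub n))

theorem IsAddApproxSubgroup.caseInt {Λ : Set ℝ} (hΛ : IsAddApproxSubgroup Λ)
    (hint : (interior Λ).Nonempty) (hb : Bornology.IsBounded Λ) : CaseInt Λ := by
  obtain ⟨a, ha, hsub⟩ := hΛ.exists_Icc_subset_add hint
  obtain ⟨R, hR⟩ := isBounded_iff_forall_norm_le.1 (hb.add hb)
  refine ⟨a, max R (a + 1), ha, by simp, hsub, fun x hx => ?_⟩
  exact abs_le.1 ((hR x hx).trans (le_max_left _ _))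

theorem classification_closed_approximate_subgroups_of_real_line
    (Λ : Set ℝ) (hΛ : IsAddApproxSubgroup Λ) (hcl : IsClosed Λ) :
    (CaseFin Λ ∨ CaseInt Λ ∨ CaseLat Λ ∨ CaseAll Λ) ∧
    ¬(CaseFin Λ ∧ CaseInt Λ) ∧ ¬(CaseFin Λ ∧ CaseLat Λ) ∧ ¬(CaseFin Λ ∧ CaseAll Λ) ∧
    ¬(CaseInt Λ ∧ CaseLat Λ) ∧ ¬(CaseInt Λ ∧ CaseAll Λ) ∧ ¬(CaseLat Λ ∧ CaseAll Λ) ∧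
    (UnifDiscrete Λ ∨ (interior Λ).Nonempty) := by
  have h0 := hΛ.2.1
  refine ⟨?_, ?_, ?_, ?_, ?_, ?_, ?_, ?_⟩
  · by_cases hud : UnifDiscrete Λ <;> by_cases hb : Bornology.IsBounded Λ
    · exact Or.inl (hud.finite_of_isBounded h0 hb)
    · obtain ⟨R, hR⟩ := hΛ.exists_add_Icc_eq_univ hb
      exact Or.inr (Or.inr (Or.inl ⟨hud, _, isCompact_Icc, hR⟩))
    · exact Or.inr (Or.inl (hΛ.caseInt (hΛ.interior_nonempty hcl hud) hb))
    · exact Or.inr (Or.inr (Or.inr (hΛ.caseAll (hΛ.interior_nonempty hcl hud) hb)))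
  · rintro ⟨hfin, a, b, ha, _, hsub, _⟩
    exact Icc_infinite (neg_lt_self ha) ((hfin.add hfin).subset hsub)
  · exact fun h => h.2.not_isBounded (Set.Finite.isBounded h.1)
  · exact fun h => h.2.not_isBounded (Set.Finite.isBounded h.1)
  · exact fun h => h.2.not_isBounded (h.1.isBounded h0)
  · exact fun h => h.2.not_isBounded (h.1.isBounded h0)
  · rintro ⟨⟨hud, _⟩, m, hm⟩
    exact Cardinal.not_countable_real (hm ▸ countable_iterSum (hud.countable h0) m)
  · exact or_iff_not_imp_left.2 (hΛ.interior_nonempty hcl)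
end
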